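/- Let μ be a probability measure on ℝ that is absolutely continuous with respect to Lebesgue measure, and let T : ℝ → ℝ be nondecreasing. Then the quantile function of the pushforward measure T#μ satisfies F⁻_{T#μ}(α) = T(F_μ⁻(α)) for Lebesgue-almost every α ∈ (0, 1). -/

import Mathlib

open MeasureTheory Set

/-- Cumulative distribution function of a measure on `ℝ`. -/
noncomputable def cdf (μ : Measure ℝ) (x : ℝ) : ℝ := (μ (Iic x)).toReal

/-- Quantile (generalized inverse cdf) of a measure on `ℝ`. -/
noncomputable def quantile (μ : Measure ℝ) (p : ℝ) : ℝ := sInf {x : ℝ | p ≤ cdf μ x}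

theorem cdf_eq_probabilityTheory_cdf (μ : Measure ℝ) [IsProbabilityMeasure μ] :
    cdf μ = ProbabilityTheory.cdf μ := by
  ext y
  rw [ProbabilityTheory.cdf_eq_real]
  rfl

open Filter Topology in
theorem quantile_le_iff (μ : Measure ℝ) [IsProbabilityMeasure μ] {p : ℝ} (hp : p ∈ Ioo (0 : ℝ) 1)
    (x : ℝ) : quantile μ p ≤ x ↔ p ≤ cdf μ x := by
  unfold quantile
  rw [cdf_eq_probabilityTheory_cdf]
  have hmono := ProbabilityTheory.monotone_cdf μ
  obtain ⟨b, hb⟩ := ((ProbabilityTheory.tendsto_cdf_atTop μ).eventually_const_le hp.2).exists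
  obtain ⟨a, ha⟩ := ((ProbabilityTheory.tendsto_cdf_atBot μ).eventually_lt_const hp.1).exists
  have hne : {y | p ≤ ProbabilityTheory.cdf μ y}.Nonempty := ⟨b, hb⟩
  have hbdd : BddBelow {y | p ≤ ProbabilityTheory.cdf μ y} :=
    ⟨a, fun y hy => le_of_not_gt fun hya => (hy.trans (hmono hya.le)).not_gt ha⟩
  refine ⟨fun h => ?_, fun h => csInf_le hbdd h⟩
  have hright : Tendsto (ProbabilityTheory.cdf μ) (𝓝[>] x) (𝓝 (ProbabilityTheory.cdf μ x)) :=
    ((ProbabilityTheory.cdf μ).right_continuous x).mono_left (nhdsWithin_mono x Ioi_subset_Ici_self)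
  refine ge_of_tendsto hright ?_
  filter_upwards [self_mem_nhdsWithin] with y hy
  obtain ⟨z, hz, hzy⟩ := exists_lt_of_csInf_lt hne (h.trans_lt hy)
  exact hz.trans (hmono hzy.le)

open Filter Topology in
theorem cdf_quantile (μ : Measure ℝ) [IsProbabilityMeasure μ] [NullSingletonClass μ] {p : ℝ}
    (hp : p ∈ Ioo (0 : ℝ) 1) : cdf μ (quantile μ p) = p := by
  refine le_antisymm ?_ ((quantile_le_iff μ hp _).1 le_rfl)
  set x := quantile μ p
  have hleft := (ProbabilityTheory.monotone_cdf μ).tendsto_leftLim x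
  have hlim : Function.leftLim (ProbabilityTheory.cdf μ) x ≤ p := by
    refine le_of_tendsto hleft ?_
    filter_upwards [self_mem_nhdsWithin] with y hy
    rw [← cdf_eq_probabilityTheory_cdf]
    exact (not_le.1 fun h => ((quantile_le_iff μ hp y).2 h).not_gt hy).le
  have hjump := (ProbabilityTheory.cdf μ).measure_singleton x
  rw [ProbabilityTheory.measure_cdf, measure_singleton, eq_comm, ENNReal.ofReal_eq_zero] at hjump
  rw [cdf_eq_probabilityTheory_cdf]
  linarith

theorem quantile_map_of_continuousAt (μ : Measure ℝ) [IsProbabilityMeasure μ]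
    {T : ℝ → ℝ} (hT : Monotone T) {p : ℝ} (hp : p ∈ Ioo (0 : ℝ) 1)
    (hc : ContinuousAt T (quantile μ p)) : quantile (μ.map T) p = T (quantile μ p) := by
  have hTm : Measurable T := hT.measurable
  have : IsProbabilityMeasure (μ.map T) := Measure.isProbabilityMeasure_map hTm.aemeasurable
  have hmap (y : ℝ) : cdf (μ.map T) y = μ.real (T ⁻¹' Iic y) := by
    rw [cdf, Measure.map_apply hTm measurableSet_Iic, measureReal_def]
  apply le_antisymm
  · rw [quantile_le_iff _ hp, hmap]
    exact ((quantile_le_iff μ hp _).1 le_rfl).trans (measureReal_mono fun z hz => hT hz)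
  · by_contra! hlt
    obtain ⟨z, hz, hzq⟩ := ((hc.eventually_const_lt hlt).filter_mono
      (nhdsWithin_le_nhds (s := Iio (quantile μ p)))).and self_mem_nhdsWithin |>.exists
    have hle := (quantile_le_iff (μ.map T) hp _).1 le_rfl
    rw [hmap] at hle
    have hsub : T ⁻¹' Iic (quantile (μ.map T) p) ⊆ Iic z := fun w hw =>
      le_of_not_gt fun hzw => (hz.trans_le (hT (le_of_lt hzw))).not_ge hw
    exact ((quantile_le_iff μ hp z).2 (hle.trans (measureReal_mono hsub))).not_gt hzq

theorem stmt19 (μ : Measure ℝ) [IsProbabilityMeasure μ] (hac : μ ≪ volume)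
    (T : ℝ → ℝ) (hT : Monotone T) :
    ∀ᵐ α ∂(volume.restrict (Ioo (0:ℝ) 1)), quantile (μ.map T) α = T (quantile μ α) := by
  have : NullSingletonClass μ := ⟨fun x => hac (measure_singleton x)⟩
  have hnull : volume (cdf μ '' {x | ¬ContinuousAt T x}) = 0 :=
    (hT.countable_not_continuousAt.image _).measure_zero _
  filter_upwards [ae_restrict_mem measurableSet_Ioo,
    ae_restrict_of_ae (measure_eq_zero_iff_ae_notMem.1 hnull)] with α hα hD
  refine quantile_map_of_continuousAt μ hT hα ?_
  by_contra hc
  exact hD ⟨_, hc, cdf_quantile μ hα⟩
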